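/- arXiv:2509.26475 — 2 statements merged into one kernel-verified Lean document; each statement's English description precedes it below -/
import Mathlib

section
/- Let A ∈ ℂ^{n×n}, let V = [v_0, …, v_p] ∈ ℂ^{n×(p+1)}, let T = diag(t_1, …, t_r) ∈ ℂ^{r×r}, and let α_1, …, α_r ∈ ℂ be nonzero. Define Γ ∈ ℂ^{(p+1)×r} by Γ_{ik} = α_k^i (i = 0:p, k = 1:r), and for each j ≥ 0 let D_j := diag(1/j!, 1/(1+j)!, …, 1/(p+j)!). Then the series G := Σ_{j=0}^∞ A^j · V · D_j · Γ · T^j converges absolutely, and for each k = 1, …, r the k-th column of G equals w_k := Σ_{i=0}^{p} α_k^i · φ_i(t_k A) · v_i. -/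
open Matrix Finset

attribute [local instance] Matrix.linftyOpNormedAddCommGroup Matrix.linftyOpNormedRing

/-- `φ_j(A) = Σ_{k=0}^∞ A^k / (k+j)!` for a square complex matrix `A`. -/
noncomputable def phi {ι : Type*} [Fintype ι] [DecidableEq ι] (j : ℕ) (A : Matrix ι ι ℂ) :
    Matrix ι ι ℂ :=
  ∑' k : ℕ, ((Nat.factorial (k + j) : ℕ) : ℂ)⁻¹ • A ^ k

theorem hasSum_phi {ι : Type*} [Fintype ι] [DecidableEq ι] (j : ℕ) (A : Matrix ι ι ℂ) :
    HasSum (fun k : ℕ => ((Nat.factorial (k + j) : ℕ) : ℂ)⁻¹ • A ^ k) (phi j A) := by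
  let : NormedAlgebra ℂ (Matrix ι ι ℂ) := Matrix.linftyOpNormedAlgebra
  refine Summable.hasSum (Summable.of_norm_bounded
    (NormedSpace.norm_expSeries_summable' (𝕂 := ℂ) A) fun k => ?_)
  rw [norm_smul, norm_smul, norm_inv, norm_inv, RCLike.norm_natCast, RCLike.norm_natCast]
  gcongr
  exact Nat.le_add_right k j

theorem hasSum_phi_mulVec_apply {ι : Type*} [Fintype ι] [DecidableEq ι] (j : ℕ)
    (A : Matrix ι ι ℂ) (t : ℂ) (x : ι → ℂ) (i : ι) :
    HasSum (fun k : ℕ => ((Nat.factorial (j + k) : ℕ) : ℂ)⁻¹ * t ^ k * ((A ^ k) *ᵥ x) i)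
      ((phi j (t • A) *ᵥ x) i) := by
  have h : HasSum (fun k : ℕ => ∑ l, (((Nat.factorial (k + j) : ℕ) : ℂ)⁻¹ • (t • A) ^ k) i l * x l)
      (∑ l, phi j (t • A) i l * x l) :=
    hasSum_sum fun l _ =>
      (Pi.hasSum.1 (Pi.hasSum.1 (hasSum_phi j (t • A)) i) l).mul_right (x l)
  refine HasSum.congr_fun h fun k => ?_
  simp only [smul_pow, Matrix.smul_apply, smul_eq_mul, Matrix.mulVec, dotProduct, Finset.mul_sum,
    add_comm k j]
  exact Finset.sum_congr rfl fun l _ => by ring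

/-- With `D_j = diag(1/j!, 1/(1+j)!, …, 1/(p+j)!)` and `Γ_{ik} = α_k^i`,
the series `G = Σ_j A^j V D_j Γ T^j` converges absolutely and its `k`-th column equals
`w_k = Σ_{i=0}^p α_k^i φ_i(t_k A) v_i`. -/
theorem block_phi_series_columns
    (n p r : ℕ)
    (A : Matrix (Fin n) (Fin n) ℂ)
    (v : Fin (p + 1) → Fin n → ℂ)
    (V : Matrix (Fin n) (Fin (p + 1)) ℂ) (hV : V = Matrix.of fun i j => v j i)
    (t : Fin r → ℂ) (T : Matrix (Fin r) (Fin r) ℂ) (hT : T = Matrix.diagonal t)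
    (α : Fin r → ℂ) (hα : ∀ k, α k ≠ 0)
    (Γ : Matrix (Fin (p + 1)) (Fin r) ℂ)
    (hΓ : Γ = Matrix.of fun (i : Fin (p + 1)) (k : Fin r) => α k ^ (i : ℕ))
    (D : ℕ → Matrix (Fin (p + 1)) (Fin (p + 1)) ℂ)
    (hD : ∀ j : ℕ, D j = Matrix.diagonal fun i : Fin (p + 1) =>
      ((Nat.factorial ((i : ℕ) + j) : ℕ) : ℂ)⁻¹) :
    Summable (fun j : ℕ => ‖A ^ j * V * D j * Γ * T ^ j‖) ∧
    ∀ k : Fin r,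
      (fun i : Fin n => (∑' j : ℕ, A ^ j * V * D j * Γ * T ^ j) i k) =
        ∑ i : Fin (p + 1), α k ^ (i : ℕ) • (phi (i : ℕ) (t k • A)).mulVec (v i) := by
  subst hV hT hΓ
  have hsum : HasSum (fun j : ℕ => A ^ j * (Matrix.of fun i j => v j i) * D j *
      (Matrix.of fun (i : Fin (p + 1)) (k : Fin r) => α k ^ (i : ℕ)) * Matrix.diagonal t ^ j)
      (Matrix.of fun i k =>
        (∑ l : Fin (p + 1), α k ^ (l : ℕ) • (phi (l : ℕ) (t k • A)).mulVec (v l)) i) := by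
    refine Pi.hasSum.2 fun i => Pi.hasSum.2 fun k => ?_
    simp only [Matrix.of_apply, Finset.sum_apply, Pi.smul_apply, smul_eq_mul]
    refine HasSum.congr_fun (hasSum_sum fun (l : Fin (p + 1)) _ =>
      (hasSum_phi_mulVec_apply (l : ℕ) A (t k) (v l) i).mul_left (α k ^ (l : ℕ))) fun j => ?_
    rw [Matrix.diagonal_pow, Matrix.mul_diagonal, hD, Matrix.mul_apply, Finset.sum_mul]
    refine Finset.sum_congr rfl fun l _ => ?_
    rw [Matrix.mul_diagonal, Matrix.mul_apply]
    simp only [Matrix.of_apply, Pi.pow_apply, Matrix.mulVec, dotProduct]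
    ring
  let : NormedSpace ℝ (Matrix (Fin n) (Fin r) ℂ) := Matrix.linftyOpNormedSpace
  refine ⟨summable_norm_iff.2 hsum.summable, fun k => funext fun i => ?_⟩
  rw [hsum.tsum_eq, Matrix.of_apply]
end

section
/- Let U ∈ ℝ^{n×r} satisfy Uᵀ·U = I_r, let M ∈ ℝ^{r×r}, let W := U·Mᵀ, and let A := U·Wᵀ ∈ ℝ^{n×n}. Then for every t ∈ ℝ, every integer p ≥ 0, and all vectors v_0, …, v_p ∈ ℝ^n: Σ_{j=0}^{p} φ_j(tA)·v_j = Σ_{j=0}^{p} (1/j!)·v_j + U·( t·Σ_{j=0}^{p} φ_{j+1}(tM)·(Wᵀ·v_j) ). -/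
open Matrix Finset

/-- `φ_j(X) = Σ_{k=0}^∞ X^k / (k+j)!` for a square real matrix `X`. -/
noncomputable def phiR {ι : Type*} [Fintype ι] [DecidableEq ι] (j : ℕ) (X : Matrix ι ι ℝ) :
    Matrix ι ι ℝ :=
  ∑' k : ℕ, ((Nat.factorial (k + j) : ℕ) : ℝ)⁻¹ • X ^ k

/-- The series defining `phiR` converges, by comparison with the exponential series. -/
theorem summable_phiR {ι : Type*} [Fintype ι] [DecidableEq ι] (j : ℕ) (X : Matrix ι ι ℝ) :
    Summable fun k : ℕ => ((Nat.factorial (k + j) : ℕ) : ℝ)⁻¹ • X ^ k := by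
  let _ : NormedRing (Matrix ι ι ℝ) := Matrix.linftyOpNormedRing
  let _ : NormedAlgebra ℝ (Matrix ι ι ℝ) := Matrix.linftyOpNormedAlgebra
  refine Summable.of_norm_bounded (NormedSpace.norm_expSeries_summable' (𝕂 := ℝ) X) fun k => ?_
  rw [norm_smul, norm_smul, norm_inv, norm_inv, Real.norm_natCast, Real.norm_natCast]
  gcongr
  omega

/-- Powers of `U V` reduce to powers of the smaller product `V U`. -/
theorem matrix_mul_pow_succ {m n R : Type*} [Fintype m] [DecidableEq m] [Fintype n] [DecidableEq n]
    [CommRing R] (U : Matrix m n R) (V : Matrix n m R) (k : ℕ) :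
    (U * V) ^ (k + 1) = U * (V * U) ^ k * V := by
  induction k with
  | zero => simp
  | succ k ih => rw [pow_succ, ih, pow_succ (V * U)]; simp only [Matrix.mul_assoc]

/-- The low-rank formula `φ_j(t U V) = (1/j!) I + t U φ_{j+1}(t V U) V`. -/
theorem phiR_smul_mul {m n : Type*} [Fintype m] [DecidableEq m] [Fintype n] [DecidableEq n]
    (U : Matrix m n ℝ) (V : Matrix n m ℝ) (t : ℝ) (j : ℕ) :
    phiR j (t • (U * V)) =
      ((Nat.factorial j : ℕ) : ℝ)⁻¹ • (1 : Matrix m m ℝ) +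
        t • (U * phiR (j + 1) (t • (V * U)) * V) := by
  let L : Matrix n n ℝ →+ Matrix m m ℝ :=
    { toFun := fun Y => t • (U * Y * V)
      map_zero' := by simp
      map_add' := fun Y Z => by rw [Matrix.mul_add, Matrix.add_mul, smul_add] }
  have hL : Continuous L := by
    change Continuous fun Y : Matrix n n ℝ => t • (U * Y * V)
    fun_prop
  have hmap := (summable_phiR (j + 1) (t • (V * U))).map_tsum L hL
  change t • (U * phiR (j + 1) (t • (V * U)) * V) = _ at hmap
  rw [hmap, phiR, (summable_phiR j _).tsum_eq_zero_add, zero_add, pow_zero]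
  congr 2
  funext k
  change _ = t • (U * (_ : Matrix n n ℝ) * V)
  rw [smul_pow, smul_pow, matrix_mul_pow_succ, add_right_comm, add_assoc k]
  simp only [Matrix.mul_smul, Matrix.smul_mul, smul_smul]
  ring_nf

/-- If `Uᵀ U = I_r`, `W = U Mᵀ` and `A = U Wᵀ`, then for every `t ∈ ℝ`,
`p ≥ 0` and vectors `v_0,…,v_p ∈ ℝ^n`:
`Σ_{j=0}^p φ_j(tA) v_j = Σ_{j=0}^p (1/j!) v_j + U (t Σ_{j=0}^p φ_{j+1}(tM) (Wᵀ v_j))`. -/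
theorem low_rank_phi_combination
    (n r : ℕ) (U : Matrix (Fin n) (Fin r) ℝ) (hU : Uᵀ * U = 1)
    (M : Matrix (Fin r) (Fin r) ℝ)
    (W : Matrix (Fin n) (Fin r) ℝ) (hW : W = U * Mᵀ)
    (A : Matrix (Fin n) (Fin n) ℝ) (hA : A = U * Wᵀ)
    (t : ℝ) (p : ℕ) (v : ℕ → Fin n → ℝ) :
    ∑ j ∈ Finset.range (p + 1), (phiR j (t • A)).mulVec (v j) =
      (∑ j ∈ Finset.range (p + 1), ((Nat.factorial j : ℝ))⁻¹ • v j) +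
        U.mulVec (t • ∑ j ∈ Finset.range (p + 1),
          (phiR (j + 1) (t • M)).mulVec (Wᵀ.mulVec (v j))) := by
  have hV : Wᵀ * U = M := by
    rw [hW, transpose_mul, transpose_transpose, Matrix.mul_assoc, hU, Matrix.mul_one]
  subst hA
  rw [mulVec_smul, mulVec_sum, smul_sum, ← sum_add_distrib]
  refine sum_congr rfl fun j _ => ?_
  rw [phiR_smul_mul, hV, add_mulVec, smul_mulVec, smul_mulVec, one_mulVec, mulVec_mulVec,
    mulVec_mulVec, Matrix.mul_assoc]
end
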